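/- arXiv:1608.06069 — 3 statements merged into one kernel-verified Lean document; each statement's English description precedes it below -/
import Mathlib

section
/- Let φ : ℍ → ℍ be a surjective isometry of the upper half-plane with its hyperbolic distance. Then there exists A ∈ SL(2,ℝ) such that either φ(z) = A•z for all z ∈ ℍ, or φ(z) = A•(−conj z) for all z ∈ ℍ (where −conj z denotes −z̄, which again lies in ℍ). Moreover the matrix A is unique up to sign: if A ∈ SL(2,ℝ) satisfies A•z = z for all z ∈ ℍ, then A = I or A = −I. (Thus PSL(2,ℝ) = SL(2,ℝ)/{±I} is identified with the group of orientation-preserving isometries of the hyperbolic plane.) -/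
open UpperHalfPlane

/-- A map preserving the distance preserves the rational expression computing its `cosh`. -/
lemma Isometry.upperHalfPlane_cross_eq {h : ℍ → ℍ} (hh : Isometry h) (z w : ℍ) :
    (((h z).re - (h w).re) ^ 2 + (h z).im ^ 2 + (h w).im ^ 2) * (z.im * w.im) =
      ((z.re - w.re) ^ 2 + z.im ^ 2 + w.im ^ 2) * ((h z).im * (h w).im) := by
  have key := congrArg Real.cosh (hh.dist_eq z w)
  have hz := z.im_pos
  have hw := w.im_pos
  have hhz := (h z).im_pos
  have hhw := (h w).im_pos
  rw [cosh_dist', cosh_dist', div_eq_div_iff (by positivity) (by positivity)] at key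
  linarith

/-- The point `2i` of the upper half-plane. -/
noncomputable def twoI : ℍ := UpperHalfPlane.mk (2 * Complex.I) (by simp)

lemma twoI_re : twoI.re = 0 := by simp [twoI, UpperHalfPlane.re]

lemma twoI_im : twoI.im = 2 := by simp [twoI, UpperHalfPlane.im]

/-- Rotations about `i` in `SL(2,ℝ)`. -/
def rotationSL (c s : ℝ) (h : c ^ 2 + s ^ 2 = 1) : Matrix.SpecialLinearGroup (Fin 2) ℝ :=
  ⟨!![c, s; -s, c], by rw [Matrix.det_fin_two_of]; linarith⟩

lemma rotationSL_smul_eq (c s : ℝ) (h : c ^ 2 + s ^ 2 = 1) {z w : ℍ}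
    (hw : (c * z + s : ℂ) = w * (-s * z + c)) : rotationSL c s h • z = w := by
  have hd : (((-s : ℝ) : ℂ) * z + (c : ℂ)) ≠ 0 :=
    denom_ne_zero (rotationSL c s h : GL (Fin 2) ℝ) z
  rw [Complex.ofReal_neg] at hd
  ext
  rw [coe_specialLinearGroup_apply]
  simpa [rotationSL] using (div_eq_iff hd).2 hw

lemma rotationSL_smul_I (c s : ℝ) (h : c ^ 2 + s ^ 2 = 1) : rotationSL c s h • I = I := by
  apply rotationSL_smul_eq
  apply Complex.ext <;> simp

/-- The stabilizer of `i` acts transitively on the circle of centre `i` through `2i`. -/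
lemma exists_smul_I_eq_and_smul_twoI_eq (w : ℍ)
    (hw : w.re ^ 2 + w.im ^ 2 + 1 = 5 / 2 * w.im) :
    ∃ A : Matrix.SpecialLinearGroup (Fin 2) ℝ, A • I = I ∧ A • twoI = w := by
  have hy := w.im_pos
  have hy1 : w.im ≤ 2 := by nlinarith [sq_nonneg w.re]
  have hy2 : 1 / 2 ≤ w.im := by nlinarith [sq_nonneg w.re]
  obtain ⟨c, s, hc, hs, hcs⟩ : ∃ c s : ℝ, c ^ 2 + s ^ 2 = 1 ∧
      w.im * (1 + 3 * s ^ 2) = 2 ∧ 2 * w.re = -3 * (c * s) * w.im := by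
    set t := (2 / w.im - 1) / 3 with ht
    have hyt : w.im * (1 + 3 * t) = 2 := by rw [ht]; field_simp; ring
    have ht0 : 0 ≤ t := by
      by_contra! hneg
      nlinarith
    have ht1 : t ≤ 1 := by
      by_contra! hlt
      nlinarith
    have hs := Real.sq_sqrt ht0
    have hc := Real.sq_sqrt (sub_nonneg.2 ht1)
    have hsq : (2 * w.re) ^ 2 = (3 * (√(1 - t) * √t) * w.im) ^ 2 := by
      have : (3 * (√(1 - t) * √t) * w.im) ^ 2 = 9 * ((1 - t) * t) * w.im ^ 2 := by
        rw [mul_pow, mul_pow, mul_pow, hs, hc]; ring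
      rw [this]
      have e : w.im * t = (2 - w.im) / 3 := by linarith
      linear_combination 4 * hw - (9 * w.im - 9 * (w.im * t) - 3 * (2 - w.im)) * e
    rcases sq_eq_sq_iff_eq_or_eq_neg.1 hsq with h | h
    · exact ⟨-√(1 - t), √t, by rw [neg_sq, hs, hc]; ring, by rw [hs, hyt], by rw [h]; ring⟩
    · exact ⟨√(1 - t), √t, by rw [hs, hc]; ring, by rw [hs, hyt], by rw [h]; ring⟩
  refine ⟨rotationSL c s hc, rotationSL_smul_I c s hc, rotationSL_smul_eq c s hc ?_⟩
  have hx : w.re = -3 * (c * s) * w.im / 2 := by linarith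
  apply Complex.ext
  · simp [twoI_re, twoI_im]
    rw [hx]
    linear_combination (-s / 2) * hs + (3 / 2 * s * w.im) * hc
  · simp [twoI_re, twoI_im]
    rw [hx]
    linear_combination (-c) * hs

/-- An isometry fixing `i` and `2i` preserves imaginary parts and squares of real parts. -/
lemma Isometry.im_eq_and_sq_re_eq {h : ℍ → ℍ} (hh : Isometry h) (h1 : h I = I)
    (h2 : h twoI = twoI) (z : ℍ) : (h z).im = z.im ∧ (h z).re ^ 2 = z.re ^ 2 := by
  have e1 := hh.upperHalfPlane_cross_eq z I
  have e2 := hh.upperHalfPlane_cross_eq z twoI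
  rw [h1] at e1
  rw [h2] at e2
  simp only [I_re, I_im, twoI_re, twoI_im] at e1 e2
  have hz := z.im_pos
  have him : (h z).im = z.im := by linarith
  refine ⟨him, ?_⟩
  rw [him] at e1
  have := mul_right_cancel₀ (by positivity) e1
  linarith

/-- An isometry fixing `i` and `2i` is the identity or the reflection `z ↦ -z̄`. -/
lemma Isometry.eq_self_or_eq_neg_conj {h : ℍ → ℍ} (hh : Isometry h) (h1 : h I = I)
    (h2 : h twoI = twoI) :
    (∀ z, h z = z) ∨ ∀ z, (h z).re = -z.re ∧ (h z).im = z.im := by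
  have key := hh.im_eq_and_sq_re_eq h1 h2
  set p : ℍ := UpperHalfPlane.mk (1 + Complex.I) (by simp)
  have pre : p.re = 1 := by simp [p, UpperHalfPlane.re]
  have pim : p.im = 1 := by simp [p, UpperHalfPlane.im]
  have cross (z : ℍ) : (h z).re * (h p).re = z.re := by
    have e := hh.upperHalfPlane_cross_eq z p
    have hz := z.im_pos
    rw [(key z).1, (key p).1] at e
    have e' := mul_right_cancel₀ (mul_pos hz p.im_pos).ne' e
    have := (key z).2
    have := (key p).2
    rw [pre] at *
    linarith
  rcases sq_eq_sq_iff_eq_or_eq_neg.1 (key p).2 with hp | hp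
  · left
    intro z
    have := cross z
    rw [hp, pre, mul_one] at this
    exact UpperHalfPlane.ext (Complex.ext this (key z).1)
  · right
    intro z
    have := cross z
    rw [hp, pre] at this
    exact ⟨by linarith, (key z).1⟩

/-- For every isometry there is an element of `SL(2,ℝ)` agreeing with it at `i` and `2i`. -/
lemma Isometry.exists_smul_I_eq_and_smul_twoI_eq {φ : ℍ → ℍ} (hφ : Isometry φ) :
    ∃ A : Matrix.SpecialLinearGroup (Fin 2) ℝ, A • I = φ I ∧ A • twoI = φ twoI := by
  set g := (φ I).toSL2R
  have hg : g • I = φ I := toSL2R_smul_I _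
  have hψ : Isometry fun z => g⁻¹ • φ z := (isometry_smul ℍ g⁻¹).comp hφ
  have hI : g⁻¹ • φ I = I := by rw [← hg, inv_smul_smul]
  have e := hψ.upperHalfPlane_cross_eq twoI I
  simp only [hI, I_re, I_im, twoI_re, twoI_im] at e
  obtain ⟨k, hk1, hk2⟩ := _root_.exists_smul_I_eq_and_smul_twoI_eq (g⁻¹ • φ twoI) (by linarith)
  exact ⟨g * k, by rw [mul_smul, hk1, hg], by rw [mul_smul, hk2, smul_inv_smul]⟩

/-- A matrix in `SL(2,ℝ)` fixing `i` and `2i` is `±1`. -/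
lemma eq_one_or_eq_neg_one_of_smul_I_eq (A : Matrix.SpecialLinearGroup (Fin 2) ℝ)
    (h1 : A • I = I) (h2 : A • twoI = twoI) :
    (A : Matrix (Fin 2) (Fin 2) ℝ) = 1 ∨ (A : Matrix (Fin 2) (Fin 2) ℝ) = -1 := by
  have fixed {z : ℍ} (hz : A • z = z) :
      (A 0 0 * z + A 0 1 : ℂ) = z * (A 1 0 * z + A 1 1) := by
    have hd : (A 1 0 * z + A 1 1 : ℂ) ≠ 0 := denom_ne_zero (A : GL (Fin 2) ℝ) z
    have := congrArg UpperHalfPlane.coe hz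
    rw [specialLinearGroup_apply] at this
    exact (div_eq_iff hd).1 this
  have e1 := fixed h1
  have e2 := fixed h2
  have e1r := congrArg Complex.re e1
  have e1i := congrArg Complex.im e1
  have e2r := congrArg Complex.re e2
  simp [twoI_re, twoI_im] at e1r e1i e2r
  have hdet := A.det_coe
  rw [Matrix.det_fin_two] at hdet
  have h10 : A 1 0 = 0 := by linarith
  have h01 : A 0 1 = 0 := by linarith
  rw [h10, e1i] at hdet
  have ha : A 1 1 ^ 2 = 1 := by linarith
  refine (by simpa using ha : A 1 1 = 1 ∨ A 1 1 = -1).imp (fun h => ?_) fun h => ?_ <;>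
    ext i j <;> fin_cases i <;> fin_cases j <;> simp [h10, h01, e1i, h]

/-- Every surjective isometry of the hyperbolic upper half-plane is either a Möbius
transformation `z ↦ A • z` with `A ∈ SL(2,ℝ)`, or such a transformation composed
with the anti-holomorphic reflection `z ↦ -z̄`; moreover the matrix is unique up to
sign: the only matrices in `SL(2,ℝ)` acting trivially are `±I`.  Thus
`PSL(2,ℝ)` is the group of orientation-preserving isometries of the hyperbolic
plane. -/
theorem hyperbolic_isometry_classification (φ : ℍ → ℍ)
    (hsurj : Function.Surjective φ) (hiso : Isometry φ) :
    (∃ A : Matrix.SpecialLinearGroup (Fin 2) ℝ,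
        (∀ z : ℍ, φ z = A • z) ∨
        (∀ z : ℍ, φ z = A • UpperHalfPlane.mk (-(starRingEnd ℂ) (z : ℂ))
            (by simpa using z.2))) ∧
    (∀ A : Matrix.SpecialLinearGroup (Fin 2) ℝ, (∀ z : ℍ, A • z = z) →
        (A : Matrix (Fin 2) (Fin 2) ℝ) = 1 ∨ (A : Matrix (Fin 2) (Fin 2) ℝ) = -1) := by
  refine ⟨?_, fun A hA => eq_one_or_eq_neg_one_of_smul_I_eq A (hA I) (hA twoI)⟩
  obtain ⟨A, hA1, hA2⟩ := hiso.exists_smul_I_eq_and_smul_twoI_eq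
  have hψ : Isometry fun z => A⁻¹ • φ z := (isometry_smul ℍ A⁻¹).comp hiso
  refine ⟨A, ?_⟩
  rcases hψ.eq_self_or_eq_neg_conj (inv_smul_eq_iff.2 hA1.symm)
    (inv_smul_eq_iff.2 hA2.symm) with h | h
  · exact Or.inl fun z => inv_smul_eq_iff.1 (h z)
  · refine Or.inr fun z => inv_smul_eq_iff.1 (UpperHalfPlane.ext (Complex.ext ?_ ?_))
    · simpa using (h z).1
    · simpa using (h z).2
end

section
/- Let W ⊆ ℝ² be a nonempty connected open set and let T : W → ℝ² be a smooth map such that for every p ∈ W the differential DT_p has positive determinant and preserves the bilinear form B, i.e. B(DT_p X, DT_p Y) = B(X, Y) for all X, Y ∈ ℝ², where B((x₁,x₂),(y₁,y₂)) = x₁y₂ + x₂y₁. Then there exist constants m ≠ 0 and c, d ∈ ℝ such that T(u,w) = (mu + d, w/m + c) for all (u,w) ∈ W. (Every orientation-preserving local isometry of the flat Lorentzian metric du⊗dw + dw⊗du on the plane is affine of this form.) -/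
/-- An endomorphism of `ℝ × ℝ` with positive determinant preserving `x₁y₂ + x₂y₁` is diagonal,
with mutually inverse diagonal entries. -/
theorem LinearMap.diagonal_of_det_pos_of_preserves_hyperbolic (L : ℝ × ℝ →ₗ[ℝ] ℝ × ℝ)
    (hdet : 0 < LinearMap.det L)
    (hB : ∀ X Y : ℝ × ℝ, (L X).1 * (L Y).2 + (L X).2 * (L Y).1 = X.1 * Y.2 + X.2 * Y.1) :
    (L (1, 0)).2 = 0 ∧ (L (0, 1)).1 = 0 ∧ (L (1, 0)).1 * (L (0, 1)).2 = 1 := by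
  have hd : LinearMap.det L = (L (1, 0)).1 * (L (0, 1)).2 - (L (0, 1)).1 * (L (1, 0)).2 := by
    rw [← LinearMap.det_toMatrix (Module.Basis.finTwoProd ℝ), Matrix.det_fin_two]
    simp [LinearMap.toMatrix_apply]
  rw [hd] at hdet
  have h11 := hB (1, 0) (1, 0)
  have h22 := hB (0, 1) (0, 1)
  have h12 := hB (1, 0) (0, 1)
  simp only [mul_zero, mul_one, add_zero] at h11 h22 h12
  generalize (L (1, 0)).1 = a at *
  generalize (L (1, 0)).2 = c at *
  generalize (L (0, 1)).1 = b at *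
  generalize (L (0, 1)).2 = e at *
  have hae : 0 < a * e := by linarith
  have ha : a ≠ 0 := left_ne_zero_of_mul hae.ne'
  have he : e ≠ 0 := right_ne_zero_of_mul hae.ne'
  have hc : c = 0 := (mul_eq_zero.mp (by linarith : a * c = 0)).resolve_left ha
  have hb : b = 0 := (mul_eq_zero.mp (by linarith : b * e = 0)).resolve_right he
  exact ⟨hc, hb, by simpa [hc] using h12⟩

/-- Every orientation-preserving local isometry of the flat Lorentzian metric
`du⊗dw + dw⊗du` on the plane, defined on a nonempty connected open set `W`,
is affine of the form `(u,w) ↦ (mu + d, w/m + c)` with `m ≠ 0`.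
The bilinear form is `B((x₁,x₂),(y₁,y₂)) = x₁y₂ + x₂y₁`; the hypotheses say the
differential of `T` preserves `B` and has positive determinant at every point of `W`. -/
theorem flat_lorentz_isometry_affine (W : Set (ℝ × ℝ)) (hW : W.Nonempty)
    (hWo : IsOpen W) (hWc : IsConnected W)
    (T : ℝ × ℝ → ℝ × ℝ) (hT : ContDiffOn ℝ (⊤ : ℕ∞) T W)
    (hdet : ∀ p ∈ W, 0 < LinearMap.det (fderiv ℝ T p : ℝ × ℝ →ₗ[ℝ] ℝ × ℝ))
    (hB : ∀ p ∈ W, ∀ X Y : ℝ × ℝ,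
      (fderiv ℝ T p X).1 * (fderiv ℝ T p Y).2 + (fderiv ℝ T p X).2 * (fderiv ℝ T p Y).1
        = X.1 * Y.2 + X.2 * Y.1) :
    ∃ m c d : ℝ, m ≠ 0 ∧ ∀ p ∈ W, T p = (m * p.1 + d, p.2 / m + c) := by
  have hdiag p (hp : p ∈ W) :=
    LinearMap.diagonal_of_det_pos_of_preserves_hyperbolic _ (hdet p hp) (hB p hp)
  simp only [ContinuousLinearMap.coe_coe] at hdiag
  have hD p (hp : p ∈ W) : HasFDerivAt (fderiv ℝ T) (fderiv ℝ (fderiv ℝ T) p) p :=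
    (((hT.contDiffAt (hWo.mem_nhds hp)).fderiv_right (m := 1)
      (by norm_cast)).differentiableAt (by simp)).hasFDerivAt
  have hfst p (hp : p ∈ W) (v : ℝ × ℝ) : HasFDerivAt (fun q ↦ (fderiv ℝ T q v).1)
      ((ContinuousLinearMap.fst ℝ ℝ ℝ).comp ((fderiv ℝ (fderiv ℝ T) p).flip v)) p :=
    ((ContinuousLinearMap.fst ℝ ℝ ℝ).comp
      (ContinuousLinearMap.apply ℝ (ℝ × ℝ) v)).hasFDerivAt.comp p (hD p hp)
  have hsnd p (hp : p ∈ W) (v : ℝ × ℝ) : HasFDerivAt (fun q ↦ (fderiv ℝ T q v).2)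
      ((ContinuousLinearMap.snd ℝ ℝ ℝ).comp ((fderiv ℝ (fderiv ℝ T) p).flip v)) p :=
    ((ContinuousLinearMap.snd ℝ ℝ ℝ).comp
      (ContinuousLinearMap.apply ℝ (ℝ × ℝ) v)).hasFDerivAt.comp p (hD p hp)
  have hzero p (hp : p ∈ W) : fderiv ℝ (fun q ↦ (fderiv ℝ T q (1, 0)).1) p = 0 := by
    have hev : ∀ᶠ q in nhds p, q ∈ W := hWo.mem_nhds hp
    have hsymm := ((hT.contDiffAt (hWo.mem_nhds hp)).isSymmSndFDerivAt
      (minSmoothness_of_isRCLikeNormedField.trans_le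
        (WithTop.coe_le_coe.2 (le_top (a := (2 : ℕ∞)))))).eq (1, 0) (0, 1)
    have h1 : (fderiv ℝ (fderiv ℝ T) p (1, 0) (0, 1)).1 = 0 := by
      have := (hfst p hp (0, 1)).unique ((hasFDerivAt_const (0 : ℝ) p).congr_of_eventuallyEq
        (hev.mono fun q hq ↦ (hdiag q hq).2.1))
      simpa using DFunLike.congr_fun this (1, 0)
    have h2 : (fderiv ℝ (fderiv ℝ T) p (0, 1) (1, 0)).2 = 0 := by
      have := (hsnd p hp (1, 0)).unique ((hasFDerivAt_const (0 : ℝ) p).congr_of_eventuallyEq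
        (hev.mono fun q hq ↦ (hdiag q hq).1))
      simpa using DFunLike.congr_fun this (0, 1)
    have h3 := DFunLike.congr_fun (((hfst p hp (1, 0)).mul (hsnd p hp (0, 1))).unique
      ((hasFDerivAt_const (1 : ℝ) p).congr_of_eventuallyEq
        (hev.mono fun q hq ↦ (hdiag q hq).2.2))) (1, 0)
    have he : (fderiv ℝ T p (0, 1)).2 ≠ 0 :=
      right_ne_zero_of_mul (by rw [(hdiag p hp).2.2]; exact one_ne_zero)
    rw [(hfst p hp (1, 0)).fderiv]
    ext
    · simpa [hsymm, h2, he] using h3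
    · simpa [← hsymm] using h1
  obtain ⟨m, hm⟩ := hWo.exists_is_const_of_fderiv_eq_zero hWc.isPreconnected
    (fun p hp ↦ (hfst p hp (1, 0)).differentiableAt.differentiableWithinAt) hzero
  have hm0 : m ≠ 0 := by
    obtain ⟨p, hp⟩ := hW
    rw [← hm p hp]
    exact left_ne_zero_of_mul (by rw [(hdiag p hp).2.2]; exact one_ne_zero)
  let L : ℝ × ℝ →L[ℝ] ℝ × ℝ := (m • ContinuousLinearMap.fst ℝ ℝ ℝ).prod
    (m⁻¹ • ContinuousLinearMap.snd ℝ ℝ ℝ)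
  have hL p (hp : p ∈ W) : fderiv ℝ T p = L := by
    obtain ⟨h1, h2, h3⟩ := hdiag p hp
    have ha := hm p hp
    rw [ha] at h3
    have he := eq_inv_of_mul_eq_one_right h3
    ext <;> simp [L, h1, h2, ha, he]
  obtain ⟨k, hk⟩ := hWo.exists_eq_add_of_fderiv_eq hWc.isPreconnected
    (hT.differentiableOn (by simp)) L.differentiableOn
    (fun p hp ↦ by rw [hL p hp, L.fderiv])
  refine ⟨m, k.2, k.1, hm0, fun p hp ↦ ?_⟩
  rw [hk hp]
  ext <;> simp [L, div_eq_inv_mul]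
end

section
/- Let W ⊆ ℝ × (0,∞) be a nonempty connected open set and let T : W → ℝ × (0,∞) be a smooth map such that for every p = (u,v) ∈ W the differential DT_p has positive determinant and satisfies (DT_p)ᵀ · G(T(p)) · DT_p = G(p), where G(u,v) = v⁻²·[[0,1],[1,0]]. Then there exist constants m ≠ 0 and c, d ∈ ℝ such that 1 − cv ≠ 0 and T(u,v) = (mu + d, mv/(1 − cv)) for all (u,v) ∈ W. (Every orientation-preserving isometry of the metric g₀ is the composition of a homothety-translation H(u,v) = (mu+d, mv) with a map Φ_c(u,v) = (u, v/(1−cv)).) -/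
/-- A vanishing derivative `HasFDerivAt f 0` on an open preconnected set makes `f` constant. -/
theorem IsOpen.exists_eq_const_of_hasFDerivAt_zero {E F : Type*}
    [NormedAddCommGroup E] [NormedSpace ℝ E] [NormedAddCommGroup F] [NormedSpace ℝ F]
    {s : Set E} {f : E → F} (hs : IsOpen s) (hs' : IsPreconnected s)
    (hf : ∀ x ∈ s, HasFDerivAt f (0 : E →L[ℝ] F) x) : ∃ a, ∀ x ∈ s, f x = a :=
  hs.exists_is_const_of_fderiv_eq_zero hs'
    (fun x hx => (hf x hx).differentiableAt.differentiableWithinAt)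
    (fun x hx => (hf x hx).fderiv)

/-- A linear endomorphism of `ℝ × ℝ` with positive determinant that rescales the bilinear form
`du⊗dv + dv⊗du` by a positive factor `k` is diagonal. -/
theorem diagonal_of_det_pos_of_conformal {A : ℝ × ℝ →L[ℝ] ℝ × ℝ} {k : ℝ} (hk : 0 < k)
    (hdet : 0 < LinearMap.det (A : ℝ × ℝ →ₗ[ℝ] ℝ × ℝ))
    (hB : ∀ X Y : ℝ × ℝ,
      (A X).1 * (A Y).2 + (A X).2 * (A Y).1 = k * (X.1 * Y.2 + X.2 * Y.1)) :
    (A (0, 1)).1 = 0 ∧ (A (1, 0)).2 = 0 ∧ (A (1, 0)).1 * (A (0, 1)).2 = k := by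
  have hd : LinearMap.det (A : ℝ × ℝ →ₗ[ℝ] ℝ × ℝ)
      = (A (1, 0)).1 * (A (0, 1)).2 - (A (0, 1)).1 * (A (1, 0)).2 := by
    rw [← LinearMap.det_toMatrix (Module.Basis.finTwoProd ℝ), Matrix.det_fin_two]
    simp [LinearMap.toMatrix_apply]
  rw [hd] at hdet
  have h1 := hB (1, 0) (1, 0)
  have h2 := hB (0, 1) (0, 1)
  have h3 := hB (1, 0) (0, 1)
  simp only [mul_zero, mul_one, add_zero] at h1 h2 h3
  have h4 : (A (1, 0)).1 * (A (1, 0)).2 = 0 := by linarith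
  have h5 : (A (0, 1)).1 * (A (0, 1)).2 = 0 := by linarith
  rcases mul_eq_zero.1 h4 with h | h
  · rw [h] at h3 hdet
    nlinarith
  · rcases mul_eq_zero.1 h5 with h' | h'
    · exact ⟨h', h, by rw [h, h'] at h3; linarith⟩
    · rw [h, h'] at hdet
      simp at hdet


/-- Every orientation-preserving isometry of the pseudo-Riemannian metric
`g₀ = (du⊗dv + dv⊗du)/v²` on the half-plane `ℝ × (0,∞)`, defined on a nonempty
connected open set `W`, has the form `(u,v) ↦ (mu + d, mv/(1 - cv))` with `m ≠ 0`,
i.e. is the composition of a homothety-translation with a map `Φ_c`.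
The isometry condition `(DT_p)ᵀ G(T p) DT_p = G(p)` with `G(u,v) = v⁻²·[[0,1],[1,0]]`
is expressed via the associated bilinear forms. -/
theorem g0_isometry_classification (W : Set (ℝ × ℝ)) (hW : W.Nonempty)
    (hWo : IsOpen W) (hWc : IsConnected W) (hWhalf : ∀ p ∈ W, 0 < p.2)
    (T : ℝ × ℝ → ℝ × ℝ) (hT : ContDiffOn ℝ (⊤ : ℕ∞) T W) (hrange : ∀ p ∈ W, 0 < (T p).2)
    (hdet : ∀ p ∈ W, 0 < LinearMap.det (fderiv ℝ T p : ℝ × ℝ →ₗ[ℝ] ℝ × ℝ))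
    (hB : ∀ p ∈ W, ∀ X Y : ℝ × ℝ,
      ((T p).2 ^ 2)⁻¹ *
          ((fderiv ℝ T p X).1 * (fderiv ℝ T p Y).2
            + (fderiv ℝ T p X).2 * (fderiv ℝ T p Y).1)
        = (p.2 ^ 2)⁻¹ * (X.1 * Y.2 + X.2 * Y.1)) :
    ∃ m c d : ℝ, m ≠ 0 ∧ ∀ p ∈ W, 1 - c * p.2 ≠ 0 ∧
      T p = (m * p.1 + d, m * p.2 / (1 - c * p.2)) := by
  have hA : ∀ p ∈ W, (fderiv ℝ T p (0, 1)).1 = 0 ∧ (fderiv ℝ T p (1, 0)).2 = 0 ∧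
      (fderiv ℝ T p (1, 0)).1 * (fderiv ℝ T p (0, 1)).2 = (T p).2 ^ 2 * (p.2 ^ 2)⁻¹ := by
    intro p hp
    have hg := hrange p hp
    have hv := hWhalf p hp
    refine diagonal_of_det_pos_of_conformal (by positivity) (hdet p hp) fun X Y => ?_
    rw [mul_assoc, ← hB p hp X Y]
    field_simp
  have hTp : ∀ p ∈ W, ContDiffAt ℝ (⊤ : ℕ∞) T p := fun p hp => hT.contDiffAt (hWo.mem_nhds hp)
  have hdT : ∀ p ∈ W, HasFDerivAt T (fderiv ℝ T p) p := fun p hp =>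
    ((hTp p hp).differentiableAt (by simp)).hasFDerivAt
  obtain ⟨m, hm⟩ : ∃ m, ∀ p ∈ W, (fderiv ℝ T p (1, 0)).1 = m := by
    refine hWo.exists_eq_const_of_hasFDerivAt_zero hWc.isPreconnected fun p hp => ?_
    have hnhds : ∀ᶠ q in nhds p, q ∈ W := hWo.mem_nhds hp
    have hv := hWhalf p hp
    have hle : ((1 : WithTop ℕ∞) + 1) ≤ ((⊤ : ℕ∞) : WithTop ℕ∞) :=
      WithTop.coe_le_coe.2 (le_top : (1 + 1 : ℕ∞) ≤ ⊤)
    set D := fderiv ℝ (fderiv ℝ T) p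
    have hD : HasFDerivAt (fderiv ℝ T) D p :=
      (((hTp p hp).fderiv_right (m := 1) hle).differentiableAt
        (by simp)).hasFDerivAt
    have hsymm : D (0, 1) (1, 0) = D (1, 0) (0, 1) :=
      ((hTp p hp).isSymmSndFDerivAt
        (by rwa [minSmoothness_of_isRCLikeNormedField, ← one_add_one_eq_two])) _ _
    have hDX : ∀ X, HasFDerivAt (fun q => fderiv ℝ T q X)
        ((ContinuousLinearMap.apply ℝ (ℝ × ℝ) X).comp D) p := fun X =>
      (ContinuousLinearMap.apply ℝ (ℝ × ℝ) X).hasFDerivAt.comp p hD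
    have hfv : (D (1, 0) (0, 1)).1 = 0 := by
      have h := (hDX (0, 1)).fst.unique
        ((hasFDerivAt_const (0 : ℝ) p).congr_of_eventuallyEq
          (hnhds.mono fun q hq => (hA q hq).1))
      simpa using DFunLike.congr_fun h (1, 0)
    have hgu : (D (1, 0) (0, 1)).2 = 0 := by
      rw [← hsymm]
      have h := (hDX (1, 0)).snd.unique
        ((hasFDerivAt_const (0 : ℝ) p).congr_of_eventuallyEq
          (hnhds.mono fun q hq => (hA q hq).2.1))
      simpa using DFunLike.congr_fun h (0, 1)
    have hfuu : (D (1, 0) (1, 0)).1 = 0 := by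
      have hl := ((hDX (1, 0)).fst.mul (hDX (0, 1)).snd).mul
        ((hasFDerivAt_snd (𝕜 := ℝ) (p := p)).pow 2)
      have h := hl.unique (((hdT p hp).snd.pow 2).congr_of_eventuallyEq
        (hnhds.mono fun q hq => by
          have := (hA q hq).2.2
          have := (hWhalf q hq).ne'
          simp only [Pi.mul_apply, *]
          field_simp))
      have h := DFunLike.congr_fun h (1, 0)
      have hgv : (fderiv ℝ T p (0, 1)).2 ≠ 0 := by
        intro h0
        have h1 := (hA p hp).2.2
        have := hrange p hp
        rw [h0, mul_zero] at h1
        exact absurd h1 (by positivity)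
      simpa [(hA p hp).2.1, hgu, hv.ne', hgv] using h
    refine (hDX (1, 0)).fst.congr_fderiv ?_
    ext <;> simp [hfuu, hsymm, hfv]
  have hm0 : m ≠ 0 := by
    obtain ⟨p, hp⟩ := hW
    rintro rfl
    have h := (hA p hp).2.2
    have := hrange p hp
    have := hWhalf p hp
    rw [hm p hp, zero_mul] at h
    exact absurd h.symm (by positivity)
  obtain ⟨d, hd⟩ : ∃ d, ∀ p ∈ W, (T p).1 - m * p.1 = d := by
    refine hWo.exists_eq_const_of_hasFDerivAt_zero hWc.isPreconnected fun p hp => ?_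
    refine ((hdT p hp).fst.sub
      ((hasFDerivAt_fst (𝕜 := ℝ) (p := p)).const_mul m)).congr_fderiv ?_
    ext <;> simp [hm p hp, (hA p hp).1]
  obtain ⟨b, hb⟩ : ∃ b, ∀ p ∈ W, p.2⁻¹ - m * (T p).2⁻¹ = b := by
    refine hWo.exists_eq_const_of_hasFDerivAt_zero hWc.isPreconnected fun p hp => ?_
    have hg := (hrange p hp).ne'
    have hv := (hWhalf p hp).ne'
    have h := (hA p hp).2.2
    rw [hm p hp] at h
    refine (((hasDerivAt_inv hv).comp_hasFDerivAt p (hasFDerivAt_snd (𝕜 := ℝ) (p := p))).sub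
      (((hasDerivAt_inv hg).comp_hasFDerivAt p (hdT p hp).snd).const_mul m)).congr_fderiv ?_
    ext
    · simp [(hA p hp).2.1]
    · simp
      field_simp at h ⊢
      linarith
  refine ⟨m, b, d, hm0, fun p hp => ?_⟩
  have hg := (hrange p hp).ne'
  have hv := (hWhalf p hp).ne'
  have hc : 1 - b * p.2 = m * p.2 / (T p).2 := by
    rw [← hb p hp]
    field_simp
    ring
  refine ⟨by rw [hc]; positivity, Prod.ext ?_ ?_⟩
  · linarith [hd p hp]
  · simp only [hc]
    field_simp
end
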